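/- arXiv:1011.1424 — 5 statements merged into one kernel-verified Lean document; each statement's English description precedes it below -/
import Mathlib

section
/- Let μ > 0, ν ∈ (0,1), and let g(x,t) = x^{μ−1} e^{−x/t} / (Γ(μ) t^{μ}) for x > 0, t > 0 (the transition density of the squared Bessel process started at 0). Then for every x > 0 and t > 0, the Riemann–Liouville time-fractional derivative of g equals the stated spatial fractional expression: (1/Γ(1−ν)) (∂/∂t) ∫_0^t (t−s)^{−ν} g(x,s) ds = (d^ν/d(−x)^ν)[ y ↦ y^{μ−1+ν} · (d^ν/d(−y)^ν)( z ↦ z^{1−μ} g(z,t) )(y) ](x), where for h : (0,∞) → ℝ the right Riemann–Liouville derivative of order ν is (d^ν h/d(−x)^ν)(x) = −(1/Γ(1−ν)) (d/dx) ∫_x^∞ (s−x)^{−ν} h(s) ds. -/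
open MeasureTheory Real

/-- Density of the squared Bessel process started at 0:
`g^1_μ(x,t) = x^(μ-1) e^(-x/t) / (Γ(μ) t^μ)`. -/
noncomputable def sqBesselDensity (μ x t : ℝ) : ℝ :=
  x ^ (μ - 1) * Real.exp (-x / t) / (Real.Gamma μ * t ^ μ)

/-- Right Riemann–Liouville fractional derivative of order `ν` on `(0,∞)`:
`(d^ν h / d(-x)^ν)(x) = -(1/Γ(1-ν)) (d/dx) ∫_x^∞ (s-x)^(-ν) h(s) ds`. -/
noncomputable def rlRightDeriv (ν : ℝ) (h : ℝ → ℝ) (x : ℝ) : ℝ :=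
  -(1 / Real.Gamma (1 - ν)) *
    deriv (fun y => ∫ s in Set.Ioi y, (s - y) ^ (-ν) * h s) x

/-- Left Riemann–Liouville fractional derivative of order `ν` in time:
`(∂^ν h / ∂t^ν)(t) = (1/Γ(1-ν)) (d/dt) ∫_0^t (t-s)^(-ν) h(s) ds`. -/
noncomputable def rlTimeDeriv (ν : ℝ) (h : ℝ → ℝ) (t : ℝ) : ℝ :=
  (1 / Real.Gamma (1 - ν)) *
    deriv (fun τ => ∫ s in (0:ℝ)..τ, (τ - s) ^ (-ν) * h s) t

lemma sqB_bound (b m q : ℝ) (hm : 0 < m) (hq : 0 < q) :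
    ∃ C : ℝ, 0 ≤ C ∧ ∀ y, m ≤ y → y ^ b ≤ C * Real.exp (q * y) := by
  rcases le_or_gt b 0 with hb | hb
  · refine ⟨m ^ b, by positivity, fun y hy => ?_⟩
    have h1 : y ^ b ≤ m ^ b := Real.rpow_le_rpow_of_nonpos hm hy hb
    have h2 : 1 ≤ Real.exp (q * y) := Real.one_le_exp (by nlinarith)
    have h3 : 0 < m ^ b := by positivity
    nlinarith
  · refine ⟨(b / q) ^ b, by positivity, fun y hy => ?_⟩
    have hy0 : 0 < y := by linarith
    have h1 : y = (b / q) * (q / b * y) := by field_simp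
    have h2 : (q / b * y) ^ b ≤ Real.exp (q / b * y) ^ b :=
      Real.rpow_le_rpow (by positivity) (by linarith [Real.add_one_le_exp (q / b * y)]) hb.le
    have h3 : Real.exp (q / b * y) ^ b = Real.exp (q * y) := by
      rw [← Real.exp_mul]; congr 1; field_simp
    calc y ^ b = (b / q) ^ b * (q / b * y) ^ b := by
          rw [← Real.mul_rpow (by positivity) (by positivity), ← h1]
      _ ≤ (b / q) ^ b * Real.exp (q * y) := by
          rw [← h3]; gcongr

/-- The kernel integrated in all steps. -/
noncomputable def sqBK (ν b x q u : ℝ) : ℝ :=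
  u ^ (-ν) * ((x + u) ^ b * Real.exp (-(q * (x + u))))

lemma sqBK_bound (ν b x q : ℝ) (hx : 0 < x) (hq : 0 < q) :
    ∃ C : ℝ, 0 ≤ C ∧ ∀ x' q' u, x / 2 < x' → q / 2 < q' → 0 < u →
      |sqBK ν b x' q' u| ≤ C * (u ^ (-ν) * Real.exp (-(q / 4 * u))) := by
  obtain ⟨C, hC, h⟩ := sqB_bound b (x / 2) (q / 4) (by positivity) (by positivity)
  refine ⟨C, hC, fun x' q' u hx' hq' hu => ?_⟩
  have hx0 : 0 < x' := by linarith
  have h1 := h (x' + u) (by linarith)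
  have h0 : 0 ≤ sqBK ν b x' q' u := by unfold sqBK; positivity
  rw [abs_of_nonneg h0, sqBK]
  have h2 : C * Real.exp (q / 4 * (x' + u)) * Real.exp (-(q' * (x' + u)))
      ≤ C * Real.exp (-(q / 4 * u)) := by
    rw [mul_assoc, ← Real.exp_add]
    gcongr
    nlinarith
  calc u ^ (-ν) * ((x' + u) ^ b * Real.exp (-(q' * (x' + u))))
      ≤ u ^ (-ν) * (C * Real.exp (q / 4 * (x' + u)) * Real.exp (-(q' * (x' + u)))) := by gcongr
    _ ≤ u ^ (-ν) * (C * Real.exp (-(q / 4 * u))) := by gcongr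
    _ = _ := by ring

lemma sqBK_meas (ν b x q : ℝ) (s : Measure ℝ) : AEStronglyMeasurable (sqBK ν b x q) s := by
  apply Measurable.aestronglyMeasurable
  unfold sqBK
  fun_prop

lemma sqB_base_int (ν q : ℝ) (hν : ν < 1) (hq : 0 < q) :
    IntegrableOn (fun u : ℝ => u ^ (-ν) * Real.exp (-(q * u))) (Set.Ioi 0) := by
  have := integrableOn_rpow_mul_exp_neg_mul_rpow (p := 1) (s := -ν) (b := q)
    (by linarith) one_pos hq
  simpa using this

lemma sqBK_int (ν b x q : ℝ) (hν : ν < 1) (hx : 0 < x) (hq : 0 < q) :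
    IntegrableOn (sqBK ν b x q) (Set.Ioi 0) := by
  obtain ⟨C, hC, h⟩ := sqBK_bound ν b x q hx hq
  refine Integrable.mono' ((sqB_base_int ν (q / 4) hν (by positivity)).const_mul C)
    (sqBK_meas _ _ _ _ _) ?_
  filter_upwards [ae_restrict_mem measurableSet_Ioi] with u hu
  exact h x q u (by linarith) (by linarith) hu

lemma sqBK_dx (ν b x q : ℝ) (hν : ν < 1) (hx : 0 < x) (hq : 0 < q) :
    HasDerivAt (fun y => ∫ u in Set.Ioi (0:ℝ), sqBK ν b y q u)
      (b * (∫ u in Set.Ioi (0:ℝ), sqBK ν (b - 1) x q u)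
        - q * ∫ u in Set.Ioi (0:ℝ), sqBK ν b x q u) x := by
  obtain ⟨C, hC, h⟩ := sqBK_bound ν b x q hx hq
  obtain ⟨C', hC', h'⟩ := sqBK_bound ν (b - 1) x q hx hq
  have key := hasDerivAt_integral_of_dominated_loc_of_deriv_le
    (μ := volume.restrict (Set.Ioi (0:ℝ)))
    (F := fun y u => sqBK ν b y q u) (x₀ := x) (s := Set.Ioi (x / 2))
    (F' := fun y u => b * sqBK ν (b - 1) y q u - q * sqBK ν b y q u)
    (bound := fun u => (|b| * C' + q * C) * (u ^ (-ν) * Real.exp (-(q / 4 * u))))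
    (Ioi_mem_nhds (by linarith)) (Filter.Eventually.of_forall fun y => sqBK_meas _ _ _ _ _)
    (sqBK_int ν b x q hν hx hq)
    (((sqBK_meas _ _ _ _ _).const_mul _).sub ((sqBK_meas _ _ _ _ _).const_mul _))
    ?_ ((sqB_base_int ν (q / 4) hν (by positivity)).const_mul _) ?_
  · have := key.2
    rwa [integral_sub ((sqBK_int ν _ x q hν hx hq).const_mul _)
      ((sqBK_int ν _ x q hν hx hq).const_mul _), integral_const_mul, integral_const_mul] at this
  · filter_upwards [ae_restrict_mem measurableSet_Ioi] with u hu y hy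
    have a1 := h y q u hy (by linarith) hu
    have a2 := h' y q u hy (by linarith) hu
    rw [Real.norm_eq_abs]
    calc _ ≤ |b * sqBK ν (b - 1) y q u| + |q * sqBK ν b y q u| := abs_sub _ _
      _ = |b| * |sqBK ν (b - 1) y q u| + q * |sqBK ν b y q u| := by
        rw [abs_mul, abs_mul, abs_of_pos hq]
      _ ≤ |b| * (C' * (u ^ (-ν) * Real.exp (-(q / 4 * u))))
          + q * (C * (u ^ (-ν) * Real.exp (-(q / 4 * u)))) := by gcongr
      _ = _ := by ring
  · filter_upwards [ae_restrict_mem measurableSet_Ioi] with u hu y hy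
    have hu : 0 < u := hu
    have hy : x / 2 < y := hy
    have e1 : HasDerivAt (fun y : ℝ => y + u) 1 y := (hasDerivAt_id y).add_const u
    have e2 := e1.rpow_const (p := b) (Or.inl (by linarith))
    have e3 := ((e1.const_mul q).neg).exp
    have e4 := (e2.mul e3).const_mul (u ^ (-ν))
    refine HasDerivAt.congr_deriv (f' := _) e4 ?_
    simp only [sqBK, Pi.neg_apply]
    ring

lemma sqBK_dq (ν b x q : ℝ) (hν : ν < 1) (hx : 0 < x) (hq : 0 < q) :
    HasDerivAt (fun r => ∫ u in Set.Ioi (0:ℝ), sqBK ν b x r u)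
      (-∫ u in Set.Ioi (0:ℝ), sqBK ν (b + 1) x q u) q := by
  obtain ⟨C, hC, h⟩ := sqBK_bound ν (b + 1) x q hx hq
  have key := hasDerivAt_integral_of_dominated_loc_of_deriv_le
    (μ := volume.restrict (Set.Ioi (0:ℝ)))
    (F := fun r u => sqBK ν b x r u) (x₀ := q) (s := Set.Ioi (q / 2))
    (F' := fun r u => - sqBK ν (b + 1) x r u)
    (bound := fun u => C * (u ^ (-ν) * Real.exp (-(q / 4 * u))))
    (Ioi_mem_nhds (by linarith)) (Filter.Eventually.of_forall fun y => sqBK_meas _ _ _ _ _)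
    (sqBK_int ν b x q hν hx hq)
    (sqBK_meas _ _ _ _ _).neg
    ?_ ((sqB_base_int ν (q / 4) hν (by positivity)).const_mul _) ?_
  · have := key.2
    rwa [integral_neg] at this
  · filter_upwards [ae_restrict_mem measurableSet_Ioi] with u hu r hr
    rw [norm_neg, Real.norm_eq_abs]
    exact h x r u (by linarith) hr hu
  · filter_upwards [ae_restrict_mem measurableSet_Ioi] with u hu r hr
    have hu : 0 < u := hu
    have e3 := (((hasDerivAt_id r).mul_const (x + u)).neg).exp
    have e4 := (e3.const_mul ((x + u) ^ b)).const_mul (u ^ (-ν))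
    refine HasDerivAt.congr_deriv (f' := _) e4 ?_
    simp only [sqBK, Pi.neg_apply]
    rw [Real.rpow_add_one (by positivity)]
    simp only [id]
    ring

lemma sqB_shift (y : ℝ) (f : ℝ → ℝ) :
    ∫ s in Set.Ioi y, f s = ∫ u in Set.Ioi (0:ℝ), f (y + u) := by
  have h := integral_image_eq_integral_abs_deriv_smul (s := Set.Ioi (0:ℝ))
    (f := fun u => y + u) (f' := fun _ => 1) measurableSet_Ioi
    (fun u _ => ((hasDerivAt_id u).const_add y).hasDerivWithinAt)
    (fun a _ b _ hab => by simpa using hab) f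
  have h2 : (fun u => y + u) '' Set.Ioi (0:ℝ) = Set.Ioi y := by simp
  rw [h2] at h
  simpa using h

lemma sqB_time (μ ν x τ : ℝ) (hx : 0 < x) (hτ : 0 < τ) :
    ∫ s in (0:ℝ)..τ, (τ - s) ^ (-ν) * sqBesselDensity μ x s =
      (Real.Gamma μ)⁻¹ * (τ ^ (1 - ν - μ) *
        ∫ u in Set.Ioi (0:ℝ), sqBK ν (μ + ν - 2) x τ⁻¹ u) := by
  rw [intervalIntegral.integral_of_le hτ.le, integral_Ioc_eq_integral_Ioo]
  have him : (fun u => x * τ / (x + u)) '' Set.Ioi (0:ℝ) = Set.Ioo 0 τ := by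
    ext s
    constructor
    · rintro ⟨u, hu, rfl⟩
      have hu : 0 < u := hu
      refine ⟨by positivity, ?_⟩
      show x * τ / (x + u) < τ
      rw [div_lt_iff₀ (by positivity)]
      nlinarith
    · rintro ⟨h0, h1⟩
      refine ⟨x * τ / s - x, ?_, ?_⟩
      · show 0 < x * τ / s - x
        rw [sub_pos, lt_div_iff₀ h0]
        nlinarith
      · show x * τ / (x + (x * τ / s - x)) = s
        field_simp
        simp
  have h := integral_image_eq_integral_abs_deriv_smul (s := Set.Ioi (0:ℝ))
    (f := fun u => x * τ / (x + u)) (f' := fun u => -(x * τ / (x + u) ^ 2)) measurableSet_Ioi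
    (fun u hu => by
      have hu : 0 < u := hu
      have e := (((hasDerivAt_id u).const_add x).inv (by simp; positivity)).const_mul (x * τ)
      have e' : HasDerivAt (fun u => x * τ / (x + u)) (-(x * τ / (x + u) ^ 2)) u := by
        refine HasDerivAt.congr_deriv (f' := _) e ?_
        simp only [id]
        ring
      exact e'.hasDerivWithinAt)
    (fun a ha b hb hab => by
      have ha : 0 < a := ha
      have hb : 0 < b := hb
      have hab : x * τ / (x + a) = x * τ / (x + b) := hab
      field_simp at hab
      linarith)
    (fun s => (τ - s) ^ (-ν) * sqBesselDensity μ x s)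
  rw [him] at h
  rw [h, ← integral_const_mul, ← integral_const_mul]
  refine setIntegral_congr_fun measurableSet_Ioi fun u hu => ?_
  have hu : 0 < u := hu
  have hxu : 0 < x + u := by positivity
  simp only [sqBesselDensity, sqBK, smul_eq_mul, abs_neg]
  rw [abs_of_pos (by positivity)]
  have e1 : τ - x * τ / (x + u) = τ * u / (x + u) := by field_simp; ring
  have e2 : -x / (x * τ / (x + u)) = -(τ⁻¹ * (x + u)) := by field_simp
  rw [e1, e2, Real.div_rpow (by positivity) hxu.le, Real.div_rpow (by positivity) hxu.le,
    Real.mul_rpow hτ.le hu.le, Real.mul_rpow hx.le hτ.le]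
  have a1 : (x + u) ^ (μ + ν - 2) = (x + u) ^ μ * (x + u) ^ ν / (x + u) ^ 2 := by
    rw [Real.rpow_sub hxu, Real.rpow_add hxu, Real.rpow_two]
  have a2 : τ ^ (1 - ν - μ) = τ / τ ^ ν / τ ^ μ := by
    rw [Real.rpow_sub hτ, Real.rpow_sub hτ, Real.rpow_one]
  have a3 : x ^ (μ - 1) = x ^ μ / x := by
    rw [Real.rpow_sub hx, Real.rpow_one]
  rw [a1, a2, a3, Real.rpow_neg hxu.le, Real.rpow_neg hτ.le]
  have := Real.rpow_pos_of_pos hxu μ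
  have := Real.rpow_pos_of_pos hxu ν
  have := Real.rpow_pos_of_pos hτ μ
  have := Real.rpow_pos_of_pos hτ ν
  have := Real.rpow_pos_of_pos hx μ
  generalize Real.exp (-(τ⁻¹ * (x + u))) = E
  generalize (Real.Gamma μ) = G
  generalize u ^ (-ν) = U
  simp only [div_eq_mul_inv, mul_inv, inv_inv]
  field_simp

lemma sqB_inner (μ ν y t : ℝ) (hν1 : ν < 1) (hy : 0 < y) (ht : 0 < t) :
    rlRightDeriv ν (fun z => z ^ (1 - μ) * sqBesselDensity μ z t) y =
      (Real.Gamma μ)⁻¹ * t ^ (-ν - μ) * Real.exp (-(t⁻¹ * y)) := by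
  have hG : 0 < Real.Gamma (1 - ν) := Real.Gamma_pos_of_pos (by linarith)
  have hev : (fun y => ∫ s in Set.Ioi y, (s - y) ^ (-ν) * (s ^ (1 - μ) * sqBesselDensity μ s t))
      =ᶠ[nhds y] fun y => ((Real.Gamma μ)⁻¹ * t ^ (-μ) * (t ^ (1 - ν) * Real.Gamma (1 - ν))) *
        Real.exp (-(t⁻¹ * y)) := by
    filter_upwards [Ioi_mem_nhds hy] with w hw
    have hw : 0 < w := hw
    rw [sqB_shift]
    have hb := Real.integral_rpow_mul_exp_neg_mul_Ioi (a := 1 - ν) (r := t⁻¹)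
      (by linarith) (by positivity)
    rw [one_div, inv_inv] at hb
    rw [← hb, mul_right_comm, ← integral_const_mul]
    refine setIntegral_congr_fun measurableSet_Ioi fun u hu => ?_
    have hu : 0 < u := hu
    have hwu : 0 < w + u := by positivity
    simp only [sqBesselDensity]
    have e1 : w + u - w = u := by ring
    have e2 : 1 - ν - 1 = -ν := by ring
    have e3 : -(w + u) / t = -(t⁻¹ * w) + -(t⁻¹ * u) := by field_simp; ring
    have e4 : (w + u) ^ (1 - μ) * (w + u) ^ (μ - 1) = 1 := by
      rw [← Real.rpow_add hwu]; simp
    rw [e1, e2, e3, Real.exp_add, Real.rpow_neg ht.le]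
    calc _ = ((w + u) ^ (1 - μ) * (w + u) ^ (μ - 1)) * (u ^ (-ν) * ((Real.exp (-(t⁻¹ * w)) *
          Real.exp (-(t⁻¹ * u))) / (Real.Gamma μ * t ^ μ))) := by ring
      _ = _ := by rw [e4, div_eq_mul_inv, mul_inv]; ring
  have hd : HasDerivAt (fun y => ((Real.Gamma μ)⁻¹ * t ^ (-μ) * (t ^ (1 - ν) * Real.Gamma (1 - ν))) *
        Real.exp (-(t⁻¹ * y))) (((Real.Gamma μ)⁻¹ * t ^ (-μ) * (t ^ (1 - ν) * Real.Gamma (1 - ν))) *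
        (Real.exp (-(t⁻¹ * y)) * -(t⁻¹ * 1))) y :=
    ((((hasDerivAt_id y).const_mul t⁻¹).neg).exp).const_mul _
  rw [rlRightDeriv, hev.deriv_eq, hd.deriv]
  have e5 : t ^ (-ν - μ) = t ^ (-μ) * t ^ (1 - ν) * t⁻¹ := by
    rw [← Real.rpow_neg_one t, ← Real.rpow_add ht, ← Real.rpow_add ht]
    congr 1; ring
  rw [e5]
  field_simp

/-- Theorem 3 of the paper: for `μ > 0`, `ν ∈ (0,1)`, the squared Bessel density
solves the space-time fractional p.d.e.
`∂^ν g/∂t^ν = d^ν/d(-x)^ν ( x^(μ-1+ν) d^ν/d(-x)^ν ( x^(1-μ) g ) )` on `(0,∞)`. -/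
theorem sqBessel_fractional_pde (μ ν : ℝ) (hμ : 0 < μ) (hν : ν ∈ Set.Ioo (0:ℝ) 1)
    (x t : ℝ) (hx : 0 < x) (ht : 0 < t) :
    rlTimeDeriv ν (fun s => sqBesselDensity μ x s) t =
      rlRightDeriv ν
        (fun y => y ^ (μ - 1 + ν) *
          rlRightDeriv ν (fun z => z ^ (1 - μ) * sqBesselDensity μ z t) y) x := by
  obtain ⟨hν0, hν1⟩ := hν
  have hti : 0 < t⁻¹ := by positivity
  -- time side
  have h1 : (fun τ => ∫ s in (0:ℝ)..τ, (τ - s) ^ (-ν) * sqBesselDensity μ x s)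
      =ᶠ[nhds t] fun τ => (Real.Gamma μ)⁻¹ * (τ ^ (1 - ν - μ) *
        ∫ u in Set.Ioi (0:ℝ), sqBK ν (μ + ν - 2) x τ⁻¹ u) := by
    filter_upwards [Ioi_mem_nhds ht] with τ hτ
    exact sqB_time μ ν x τ hx hτ
  have d1 := (((hasDerivAt_id t).rpow_const (p := 1 - ν - μ) (Or.inl ht.ne')).mul
    ((sqBK_dq ν (μ + ν - 2) x t⁻¹ hν1 hx hti).comp t (hasDerivAt_inv ht.ne'))).const_mul
      (Real.Gamma μ)⁻¹
  -- space side
  have h2 : (fun y => ∫ s in Set.Ioi y, (s - y) ^ (-ν) * (s ^ (μ - 1 + ν) *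
        rlRightDeriv ν (fun z => z ^ (1 - μ) * sqBesselDensity μ z t) s))
      =ᶠ[nhds x] fun y => ((Real.Gamma μ)⁻¹ * t ^ (-ν - μ)) *
        ∫ u in Set.Ioi (0:ℝ), sqBK ν (μ + ν - 1) y t⁻¹ u := by
    filter_upwards [Ioi_mem_nhds hx] with y hy
    have hy : 0 < y := hy
    rw [sqB_shift, ← integral_const_mul]
    refine setIntegral_congr_fun measurableSet_Ioi fun u hu => ?_
    have hu : 0 < u := hu
    rw [sqB_inner μ ν (y + u) t hν1 (by positivity) ht, sqBK,
      show y + u - y = u by ring, show μ - 1 + ν = μ + ν - 1 by ring]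
    ring
  have d2 := (sqBK_dx ν (μ + ν - 1) x t⁻¹ hν1 hx hti).const_mul
    ((Real.Gamma μ)⁻¹ * t ^ (-ν - μ))
  have d1' := d1.deriv
  simp only [Function.comp_def, id] at d1'
  rw [rlTimeDeriv, rlRightDeriv, h1.deriv_eq, h2.deriv_eq, d2.deriv]
  refine (congrArg _ d1').trans ?_
  rw [show μ + ν - 2 + 1 = μ + ν - 1 by ring, show μ + ν - 1 - 1 = μ + ν - 2 by ring,
    show 1 - ν - μ - 1 = -ν - μ by ring, show 1 - ν - μ = (-ν - μ) + 1 by ring,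
    Real.rpow_add_one ht.ne']
  field_simp
  ring
end

section
/- Let γ ≠ 0 be real and μ > 0. For x > 0 and t > 0 let g̃^γ_μ(x,t) = |γ| x^{γμ−1} e^{−x^γ/t} / (Γ(μ) t^{μ}). Then g̃^γ_μ solves the forward equation ∂/∂t g̃^γ_μ(x,t) = (1/γ²) ∂/∂x [ x^{γμ−γ+1} ∂/∂x ( x^{1−γμ} g̃^γ_μ(x,t) ) ] for all x > 0, t > 0. -/
open Real

/-- `g̃^γ_μ(x,t) = |γ| x^(γμ-1) e^(-x^γ/t) / (Γ(μ) t^μ)`. -/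
noncomputable def gTilde (γ μ x t : ℝ) : ℝ :=
  |γ| * x ^ (γ * μ - 1) * Real.exp (-(x ^ γ) / t) / (Real.Gamma μ * t ^ μ)

/-- The case `ν = 1` of Theorem 1 of the paper: `g̃^γ_μ` solves the forward equation
`∂_t g̃ = (1/γ²) ∂_x ( x^(γμ-γ+1) ∂_x ( x^(1-γμ) g̃ ) )` on `(0,∞) × (0,∞)`. -/
theorem gTilde_forward_equation (γ μ : ℝ) (hγ : γ ≠ 0) (hμ : 0 < μ)
    (x t : ℝ) (hx : 0 < x) (ht : 0 < t) :
    deriv (fun τ => gTilde γ μ x τ) t =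
      (1 / γ ^ 2) *
        deriv (fun y => y ^ (γ * μ - γ + 1) *
          deriv (fun z => z ^ (1 - γ * μ) * gTilde γ μ z t) y) x := by
  have hG : Real.Gamma μ ≠ 0 := (Real.Gamma_pos_of_pos hμ).ne'
  have hT : t ^ μ ≠ 0 := (Real.rpow_pos_of_pos ht μ).ne'
  have ht0 : t ≠ 0 := ht.ne'
  have hx0 : x ≠ 0 := hx.ne'
  have hL : HasDerivAt (fun τ => gTilde γ μ x τ)
      (|γ| * x ^ (γ * μ - 1) * Real.exp (-(x ^ γ) / t) / (Real.Gamma μ * t ^ μ)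
        * (x ^ γ / t ^ 2 - μ / t)) t := by
    unfold gTilde
    have h1 : HasDerivAt (fun τ : ℝ => -(x ^ γ) / τ) (x ^ γ / t ^ 2) t := by
      have := (hasDerivAt_inv ht0).const_mul (-(x ^ γ))
      refine HasDerivAt.congr_deriv (f := fun τ : ℝ => -(x ^ γ) / τ) this ?_
      field_simp
    have h2 := (Real.hasDerivAt_rpow_const (x := t) (p := μ) (Or.inl ht0)).const_mul
      (Real.Gamma μ)
    have h3 := (h1.exp.const_mul (|γ| * x ^ (γ * μ - 1))).div h2 (mul_ne_zero hG hT)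
    refine HasDerivAt.congr_deriv (f := fun τ : ℝ => |γ| * x ^ (γ * μ - 1) *
      Real.exp (-(x ^ γ) / τ) / (Real.Gamma μ * τ ^ μ)) h3 ?_
    rw [Real.rpow_sub_one ht0]
    field_simp
  have hA : ∀ y : ℝ, 0 < y → HasDerivAt (fun z : ℝ => Real.exp (-(z ^ γ) / t))
      (Real.exp (-(y ^ γ) / t) * (-(γ * y ^ (γ - 1)) / t)) y := by
    intro y hy
    exact (((Real.hasDerivAt_rpow_const (x := y) (p := γ) (Or.inl hy.ne')).neg).div_const t).exp
  have hB : ∀ y : ℝ, 0 < y →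
      deriv (fun z => z ^ (1 - γ * μ) * gTilde γ μ z t) y =
        |γ| / (Real.Gamma μ * t ^ μ) *
          (Real.exp (-(y ^ γ) / t) * (-(γ * y ^ (γ - 1)) / t)) := by
    intro y hy
    refine HasDerivAt.deriv (((hA y hy).const_mul _).congr_of_eventuallyEq ?_)
    filter_upwards [lt_mem_nhds hy] with z hz
    have e : z ^ (1 - γ * μ) * z ^ (γ * μ - 1) = 1 := by
      rw [← Real.rpow_add hz]
      simp
    unfold gTilde
    linear_combination (|γ| * Real.exp (-(z ^ γ) / t) / (Real.Gamma μ * t ^ μ)) * e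
  have hR : HasDerivAt (fun y => y ^ (γ * μ - γ + 1) *
          deriv (fun z => z ^ (1 - γ * μ) * gTilde γ μ z t) y)
      (-(|γ| / (Real.Gamma μ * t ^ μ) * γ / t) *
        (γ * μ * x ^ (γ * μ - 1) * Real.exp (-(x ^ γ) / t) +
          x ^ (γ * μ) * (Real.exp (-(x ^ γ) / t) * (-(γ * x ^ (γ - 1)) / t)))) x := by
    refine (((Real.hasDerivAt_rpow_const (x := x) (p := γ * μ) (Or.inl hx0)).mul
      (hA x hx)).const_mul _).congr_of_eventuallyEq ?_
    filter_upwards [lt_mem_nhds hx] with y hy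
    rw [hB y hy]
    have e : y ^ (γ * μ - γ + 1) * y ^ (γ - 1) = y ^ (γ * μ) := by
      rw [← Real.rpow_add hy]
      congr 1
      ring
    simp only [Pi.mul_apply]
    rw [← e]
    ring
  rw [hL.deriv, hR.deriv, Real.rpow_sub_one hx0, Real.rpow_sub_one hx0]
  field_simp
  ring
end

section
/- Let μ > 0, ν ∈ (0,1), t > 0, and let η be real with max(0, 1+ν−μ) < η < 1. Let g(x,t) = x^{μ−1} e^{−x/t}/(Γ(μ) t^{μ}). Then ∫_0^∞ x^{η−1} (∂^ν/∂x^ν)[ y ↦ y^{μ−1+ν} · (d^ν/d(−y)^ν)( z ↦ z^{1−μ} g(z,t) )(y) ](x) dx = [Γ(1−η+ν)/Γ(1−η)] · [Γ(η+μ−1)/Γ(μ)] · t^{η−ν−1}. In other words, the Mellin transform of the space-fractional operator 𝒜 f = −∂^ν/∂x^ν( x^{μ−1+ν} d^ν/d(−x)^ν ( x^{1−μ} f ) ) applied to the squared Bessel density satisfies M[𝒜 g(·,t)](η) = −[Γ(1−η+ν)/Γ(1−η)]·[Γ(η+μ−1)/Γ(η+μ−1−ν)]·M[g(·,t)](η−ν).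 -/
open MeasureTheory Real

/-- Left Riemann–Liouville fractional derivative of order `ν` on `(0,∞)`:
`(∂^ν h/∂x^ν)(x) = (1/Γ(1-ν)) (d/dx) ∫_0^x (x-s)^(-ν) h(s) ds`. -/
noncomputable def rlLeftDeriv (ν : ℝ) (h : ℝ → ℝ) (x : ℝ) : ℝ :=
  (1 / Real.Gamma (1 - ν)) *
    deriv (fun y => ∫ s in (0:ℝ)..y, (y - s) ^ (-ν) * h s) x

open Set in
lemma aux_beta {p q : ℝ} (hp : 0 < p) (hq : 0 < q) :
    IntegrableOn (fun u : ℝ => (1 - u) ^ (q - 1) * u ^ (p - 1)) (Ioc 0 1) ∧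
    ∫ u in Ioc (0:ℝ) 1, (1 - u) ^ (q - 1) * u ^ (p - 1) =
      Real.Gamma p * Real.Gamma q / Real.Gamma (p + q) := by
  have hconv := Complex.betaIntegral_convergent (u := (p : ℂ)) (v := (q : ℂ))
    (by simpa using hp) (by simpa using hq)
  have heq : ∀ u ∈ Ioc (0:ℝ) 1, (u : ℂ) ^ ((p : ℂ) - 1) * (1 - (u : ℂ)) ^ ((q : ℂ) - 1) =
      (((1 - u) ^ (q - 1) * u ^ (p - 1) : ℝ) : ℂ) := by
    intro u hu
    rw [Complex.ofReal_mul, Complex.ofReal_cpow (by linarith [hu.2]),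
      Complex.ofReal_cpow hu.1.le]
    push_cast
    ring
  rw [intervalIntegrable_iff_integrableOn_Ioc_of_le zero_le_one] at hconv
  have hB := Complex.betaIntegral_eq_Gamma_mul_div (p : ℂ) (q : ℂ)
    (by simpa using hp) (by simpa using hq)
  rw [Complex.betaIntegral, intervalIntegral.integral_of_le zero_le_one,
    setIntegral_congr_fun measurableSet_Ioc heq, integral_complex_ofReal,
    ← Complex.ofReal_add, Complex.Gamma_ofReal, Complex.Gamma_ofReal, Complex.Gamma_ofReal] at hB
  refine ⟨?_, by exact_mod_cast hB⟩
  have h2 := (hconv.congr_fun heq measurableSet_Ioc).re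
  simp only [RCLike.re_to_complex, Complex.ofReal_re] at h2
  exact h2

open Set in
lemma aux_gamma {s r : ℝ} (hs : 0 < s) (hr : 0 < r) :
    IntegrableOn (fun x : ℝ => x ^ (s - 1) * Real.exp (-(r * x))) (Ioi 0) := by
  have := integrableOn_rpow_mul_exp_neg_mul_rpow (p := 1) (s := s - 1) (b := r) (by linarith)
    one_pos hr
  simpa using this

open Set in
lemma aux_right {ν t y : ℝ} (hν1 : ν < 1) (ht : 0 < t) :
    ∫ s in Ioi y, (s - y) ^ (-ν) * Real.exp (-s / t) =
      Real.exp (-y / t) * (t ^ (1 - ν) * Real.Gamma (1 - ν)) := by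
  have h := (measurePreserving_add_right (volume : Measure ℝ) y).setIntegral_preimage_emb
    (measurableEmbedding_addRight y) (fun s => (s - y) ^ (-ν) * Real.exp (-s / t)) (Ioi y)
  have hpre : (fun x : ℝ => x + y) ⁻¹' (Ioi y) = Ioi 0 := by
    ext x; simp
  rw [← h, hpre]
  have hG := Real.integral_rpow_mul_exp_neg_mul_Ioi (a := 1 - ν) (r := 1 / t) (by linarith)
    (by positivity)
  rw [one_div_one_div] at hG
  rw [← hG, ← integral_const_mul]
  refine setIntegral_congr_fun measurableSet_Ioi fun x _ => ?_
  simp only [add_sub_cancel_right]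
  rw [mul_left_comm, ← Real.exp_add]
  congr 2
  · ring
  · ring

open Set in
lemma aux_rightDeriv {μ ν t y : ℝ} (hν1 : ν < 1) (ht : 0 < t) (hy : 0 < y) :
    rlRightDeriv ν (fun z => z ^ (1 - μ) * sqBesselDensity μ z t) y =
      t ^ (-ν) / (Real.Gamma μ * t ^ μ) * Real.exp (-y / t) := by
  have hev : (fun y : ℝ => ∫ s in Ioi y, (s - y) ^ (-ν) *
      (s ^ (1 - μ) * sqBesselDensity μ s t)) =ᶠ[nhds y]
      fun y => (1 / (Real.Gamma μ * t ^ μ) * (t ^ (1 - ν) * Real.Gamma (1 - ν))) *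
        Real.exp (-y / t) := by
    filter_upwards [lt_mem_nhds hy] with w hw
    have : (1 / (Real.Gamma μ * t ^ μ) * (t ^ (1 - ν) * Real.Gamma (1 - ν))) *
        Real.exp (-w / t) = 1 / (Real.Gamma μ * t ^ μ) *
        (Real.exp (-w / t) * (t ^ (1 - ν) * Real.Gamma (1 - ν))) := by ring
    rw [this, ← aux_right hν1 ht, ← integral_const_mul]
    refine setIntegral_congr_fun measurableSet_Ioi fun s hs => ?_
    have hs0 : 0 < s := lt_trans hw hs
    have h1 : s ^ (1 - μ) * s ^ (μ - 1) = 1 := by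
      rw [← Real.rpow_add hs0]; simp
    simp only [sqBesselDensity]
    calc _ = (s ^ (1 - μ) * s ^ (μ - 1)) * ((s - w) ^ (-ν) * Real.exp (-s / t)) *
          (1 / (Real.Gamma μ * t ^ μ)) := by ring
      _ = _ := by rw [h1]; ring
  have hd : HasDerivAt (fun y : ℝ => Real.exp (-y / t)) (Real.exp (-y / t) * (-1 / t)) y :=
    (((hasDerivAt_id y).neg).div_const t).exp
  rw [rlRightDeriv, hev.deriv_eq, (hd.const_mul _).deriv]
  have hG : Real.Gamma (1 - ν) ≠ 0 := (Real.Gamma_pos_of_pos (by linarith)).ne'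
  have h2 : t ^ (1 - ν) = t * t ^ (-ν) := by
    rw [show 1 - ν = 1 + -ν by ring, Real.rpow_add ht, Real.rpow_one]
  rw [h2]
  field_simp

/-- The auxiliary parametric integral. -/
noncomputable def auxPhi (ν t p x : ℝ) : ℝ :=
  ∫ u in Set.Ioc (0:ℝ) 1, (1 - u) ^ (-ν) * u ^ (p - 1) * Real.exp (-x * u / t)

open Set in
lemma aux_phi_deriv {ν t p x : ℝ} (hν1 : ν < 1) (ht : 0 < t) (hp : 0 < p) (hx : 0 < x) :
    HasDerivAt (auxPhi ν t p) (-(1 / t) * auxPhi ν t (p + 1) x) x := by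
  have hI : ∀ q : ℝ, 0 < q →
      IntegrableOn (fun u : ℝ => (1 - u) ^ (-ν) * u ^ (q - 1)) (Ioc 0 1) := by
    intro q hq
    have := (aux_beta hq (show 0 < 1 - ν by linarith)).1
    simpa using this
  have hmeas : ∀ q z : ℝ, AEStronglyMeasurable
      (fun u : ℝ => (1 - u) ^ (-ν) * u ^ (q - 1) * Real.exp (-z * u / t))
      (volume.restrict (Ioc 0 1)) := by
    intro q z
    apply Measurable.aestronglyMeasurable
    fun_prop
  have key := hasDerivAt_integral_of_dominated_loc_of_deriv_le
    (μ := volume.restrict (Ioc (0:ℝ) 1)) (s := Ioi 0) (x₀ := x)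
    (F := fun x u => (1 - u) ^ (-ν) * u ^ (p - 1) * Real.exp (-x * u / t))
    (F' := fun x u => -(1 / t) * ((1 - u) ^ (-ν) * u ^ (p + 1 - 1) * Real.exp (-x * u / t)))
    (bound := fun u => (1 / t) * ((1 - u) ^ (-ν) * u ^ (p + 1 - 1)))
    (Ioi_mem_nhds hx) (Filter.Eventually.of_forall fun z => hmeas p z) ?_
    ((hmeas (p + 1) x).const_mul _) ?_ ((hI (p + 1) (by linarith)).const_mul _) ?_
  · have := key.2
    rw [integral_const_mul] at this
    exact this
  · refine (hI p hp).mono' (hmeas p x) ?_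
    filter_upwards [ae_restrict_mem measurableSet_Ioc] with u hu
    have h1 : 0 ≤ (1 - u) ^ (-ν) := Real.rpow_nonneg (by linarith [hu.2]) _
    have h2 : 0 ≤ u ^ (p - 1) := Real.rpow_nonneg hu.1.le _
    rw [Real.norm_of_nonneg (by positivity)]
    refine mul_le_of_le_one_right (by positivity) (Real.exp_le_one_iff.2 ?_)
    rw [neg_mul, neg_div]
    have := hu.1
    have : 0 ≤ x * u / t := by positivity
    linarith
  · filter_upwards [ae_restrict_mem measurableSet_Ioc] with u hu z hz
    have h1 : 0 ≤ (1 - u) ^ (-ν) := Real.rpow_nonneg (by linarith [hu.2]) _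
    have h2 : 0 ≤ u ^ (p + 1 - 1) := Real.rpow_nonneg hu.1.le _
    rw [norm_mul, norm_neg, Real.norm_of_nonneg (by positivity : 0 ≤ 1 / t),
      Real.norm_of_nonneg (by positivity)]
    refine mul_le_mul_of_nonneg_left ?_ (by positivity)
    refine mul_le_of_le_one_right (by positivity) (Real.exp_le_one_iff.2 ?_)
    rw [neg_mul, neg_div]
    have := hu.1
    have hz : 0 < z := hz
    have : 0 ≤ z * u / t := by positivity
    linarith
  · filter_upwards [ae_restrict_mem measurableSet_Ioc] with u hu z hz
    have hd : HasDerivAt (fun z : ℝ => Real.exp (-z * u / t))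
        (Real.exp (-z * u / t) * (-1 * u / t)) z :=
      ((((hasDerivAt_id z).neg).mul_const u).div_const t).exp
    have h0 := hd.const_mul ((1 - u) ^ (-ν) * u ^ (p - 1))
    refine h0.congr_deriv ?_
    have : u ^ (p + 1 - 1) = u ^ (p - 1) * u := by
      rw [show p + 1 - 1 = (p - 1) + 1 by ring, Real.rpow_add hu.1, Real.rpow_one]
    rw [this]
    ring

open Set in
lemma aux_phi_mellin {ν t p s : ℝ} (hν1 : ν < 1) (ht : 0 < t) (hs : 0 < s) (hps : 0 < p - s) :
    IntegrableOn (fun x => x ^ (s - 1) * auxPhi ν t p x) (Ioi 0) ∧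
    ∫ x in Ioi (0:ℝ), x ^ (s - 1) * auxPhi ν t p x =
      Real.Gamma s * t ^ s *
        (Real.Gamma (p - s) * Real.Gamma (1 - ν) / Real.Gamma (p - s + (1 - ν))) := by
  obtain ⟨hBi, hBv⟩ := aux_beta hps (show 0 < 1 - ν by linarith)
  let f : ℝ → ℝ → ℝ := fun x u =>
    x ^ (s - 1) * ((1 - u) ^ (-ν) * u ^ (p - 1) * Real.exp (-x * u / t))
  have hform : ∀ u x : ℝ, f x u = ((1 - u) ^ (-ν) * u ^ (p - 1)) *
      (x ^ (s - 1) * Real.exp (-((u / t) * x))) := by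
    intro u x
    simp only [f]
    rw [show -x * u / t = -((u / t) * x) by ring]
    ring
  have hinner : ∀ u ∈ Ioc (0:ℝ) 1, ∫ x in Ioi (0:ℝ), f x u =
      Real.Gamma s * t ^ s * ((1 - u) ^ (1 - ν - 1) * u ^ (p - s - 1)) := by
    intro u hu
    have hu0 := hu.1
    simp_rw [hform u]
    rw [integral_const_mul, Real.integral_rpow_mul_exp_neg_mul_Ioi hs (by positivity),
      one_div_div, Real.div_rpow ht.le hu0.le, show 1 - ν - 1 = -ν by ring,
      show p - s - 1 = (p - 1) - s by ring, Real.rpow_sub hu0 (p - 1) s]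
    ring
  have hint : Integrable (Function.uncurry f)
      ((volume.restrict (Ioi (0:ℝ))).prod (volume.restrict (Ioc (0:ℝ) 1))) := by
    have hm : Measurable (Function.uncurry f) := by
      simp only [f, Function.uncurry_def]
      fun_prop
    rw [integrable_prod_iff' hm.aestronglyMeasurable]
    constructor
    · filter_upwards [ae_restrict_mem measurableSet_Ioc] with u hu
      have hu0 := hu.1
      simp only [Function.uncurry_apply_pair]
      simp_rw [hform u]
      exact (aux_gamma hs (by positivity : 0 < u / t)).const_mul _
    · refine (hBi.const_mul (Real.Gamma s * t ^ s)).congr ?_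
      filter_upwards [ae_restrict_mem measurableSet_Ioc] with u hu
      rw [← hinner u hu]
      refine setIntegral_congr_fun measurableSet_Ioi fun x hx => ?_
      have hx : 0 < x := hx
      have h1 : 0 ≤ (1 - u) ^ (-ν) := Real.rpow_nonneg (by linarith [hu.2]) _
      have h2 : 0 ≤ u ^ (p - 1) := Real.rpow_nonneg hu.1.le _
      simp only [Function.uncurry_apply_pair]
      rw [Real.norm_of_nonneg]
      simp only [f]
      positivity
  have hphi : ∀ x, x ^ (s - 1) * auxPhi ν t p x = ∫ u in Ioc (0:ℝ) 1, f x u := by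
    intro x
    simp only [f, auxPhi]
    rw [integral_const_mul]
  simp_rw [hphi]
  refine ⟨hint.integral_prod_left, ?_⟩
  rw [integral_integral_swap hint, setIntegral_congr_fun measurableSet_Ioc hinner,
    integral_const_mul, hBv]

open Set in
lemma aux_leftDeriv {ν t μ C x : ℝ} {h : ℝ → ℝ} (hμ : 0 < μ) (hν0 : 0 < ν) (hν1 : ν < 1)
    (ht : 0 < t) (hx : 0 < x)
    (hh : ∀ y, 0 < y → h y = y ^ (μ - 1 + ν) * (C * Real.exp (-y / t))) :
    rlLeftDeriv ν h x = (1 / Real.Gamma (1 - ν)) * (C *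
      (μ * x ^ (μ - 1) * auxPhi ν t (μ + ν) x +
        x ^ μ * (-(1 / t) * auxPhi ν t (μ + ν + 1) x))) := by
  have hev : (fun y : ℝ => ∫ s in (0:ℝ)..y, (y - s) ^ (-ν) * h s) =ᶠ[nhds x]
      fun y => C * (y ^ μ * auxPhi ν t (μ + ν) y) := by
    filter_upwards [lt_mem_nhds hx] with y hy
    have h1 := intervalIntegral.mul_integral_comp_mul_left (a := 0) (b := 1)
      (f := fun s => (y - s) ^ (-ν) * h s) (c := y)
    rw [mul_zero, mul_one] at h1
    rw [← h1, intervalIntegral.integral_of_le zero_le_one, auxPhi, ← integral_const_mul,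
      ← integral_const_mul, ← integral_const_mul]
    refine setIntegral_congr_fun measurableSet_Ioc fun u hu => ?_
    have hu0 := hu.1
    rw [hh _ (by positivity), show y - y * u = y * (1 - u) by ring,
      Real.mul_rpow hy.le (by linarith [hu.2]), Real.mul_rpow hy.le hu0.le,
      show -(y * u) / t = -y * u / t by ring, show μ - 1 + ν = μ + ν - 1 by ring]
    have h3 : y ^ μ = y * y ^ (-ν) * y ^ (μ + ν - 1) := by
      nth_rw 2 [← Real.rpow_one y]
      rw [← Real.rpow_add hy, ← Real.rpow_add hy]
      congr 1; ring
    rw [h3]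
    ring
  rw [rlLeftDeriv, hev.deriv_eq]
  have hd := ((Real.hasDerivAt_rpow_const (p := μ) (Or.inl hx.ne')).mul
    (aux_phi_deriv (p := μ + ν) hν1 ht (by linarith) hx)).const_mul C
  have hd' : HasDerivAt (fun y => C * (y ^ μ * auxPhi ν t (μ + ν) y)) _ x := hd
  rw [hd'.deriv]

theorem mellin_space_fractional_operator (μ ν t η : ℝ) (hμ : 0 < μ)
    (hν : ν ∈ Set.Ioo (0:ℝ) 1) (ht : 0 < t)
    (hη₁ : max 0 (1 + ν - μ) < η) (hη₂ : η < 1) :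
    (∫ x in Set.Ioi (0:ℝ), x ^ (η - 1) *
        rlLeftDeriv ν
          (fun y => y ^ (μ - 1 + ν) *
            rlRightDeriv ν (fun z => z ^ (1 - μ) * sqBesselDensity μ z t) y) x) =
      (Real.Gamma (1 - η + ν) / Real.Gamma (1 - η)) *
        (Real.Gamma (η + μ - 1) / Real.Gamma μ) * t ^ (η - ν - 1) := by
  obtain ⟨hν0, hν1⟩ := hν
  have hη0 : 0 < η := lt_of_le_of_lt (le_max_left _ _) hη₁
  have hη3 : 1 + ν - μ < η := lt_of_le_of_lt (le_max_right _ _) hη₁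
  set s := η + μ - 1 with hs
  have hs0 : 0 < s := by linarith
  obtain ⟨i1, v1⟩ := aux_phi_mellin (p := μ + ν) hν1 ht hs0 (by linarith)
  obtain ⟨i2, v2⟩ := aux_phi_mellin (p := μ + ν + 1) (s := s + 1) hν1 ht (by linarith)
    (by linarith)
  set C := t ^ (-ν) / (Real.Gamma μ * t ^ μ) with hC
  have hmain : ∀ x ∈ Set.Ioi (0:ℝ), x ^ (η - 1) *
        rlLeftDeriv ν
          (fun y => y ^ (μ - 1 + ν) *
            rlRightDeriv ν (fun z => z ^ (1 - μ) * sqBesselDensity μ z t) y) x =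
      (1 / Real.Gamma (1 - ν) * C * μ) * (x ^ (s - 1) * auxPhi ν t (μ + ν) x) +
      (-(1 / Real.Gamma (1 - ν) * C * (1 / t))) *
        (x ^ (s + 1 - 1) * auxPhi ν t (μ + ν + 1) x) := by
    intro x hx
    have hx : 0 < x := hx
    rw [aux_leftDeriv (μ := μ) (C := C) hμ hν0 hν1 ht hx]
    · rw [show s - 1 = (η - 1) + (μ - 1) by rw [hs]; ring,
        show s + 1 - 1 = (η - 1) + μ by rw [hs]; ring, Real.rpow_add hx, Real.rpow_add hx]
      ring
    · intro y hy
      rw [aux_rightDeriv hν1 ht hy]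
  have hT : t ^ (η - ν - 1) = t ^ s * t ^ (-ν) / t ^ μ := by
    rw [← Real.rpow_add ht, ← Real.rpow_sub ht]
    congr 1; rw [hs]; ring
  rw [setIntegral_congr_fun measurableSet_Ioi hmain,
    integral_add (i1.const_mul _) (i2.const_mul _), integral_const_mul, integral_const_mul, v1, v2,
    show μ + ν + 1 - (s + 1) = 1 - η + ν by rw [hs]; ring,
    show μ + ν - s = 1 - η + ν by rw [hs]; ring,
    show 1 - η + ν + (1 - ν) = (1 - η) + 1 by ring,
    Real.Gamma_add_one hs0.ne', Real.Gamma_add_one (by linarith : (1 - η) ≠ 0),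
    Real.rpow_add ht s 1, Real.rpow_one, hT, hC]
  have g1 : Real.Gamma (1 - ν) ≠ 0 := (Real.Gamma_pos_of_pos (by linarith)).ne'
  have g2 : Real.Gamma μ ≠ 0 := (Real.Gamma_pos_of_pos hμ).ne'
  have g3 : Real.Gamma (1 - η) ≠ 0 := (Real.Gamma_pos_of_pos (by linarith)).ne'
  have g4 : t ^ μ ≠ 0 := (Real.rpow_pos_of_pos ht _).ne'
  have g5 : 1 - η ≠ 0 := by linarith
  have hsμ : s = μ - (1 - η) := by rw [hs]; ring
  generalize Real.Gamma s = G
  generalize t ^ s = T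
  generalize t ^ (-ν) = N
  generalize t ^ μ = M at *
  generalize Real.Gamma (1 - η + ν) = K
  rw [hsμ]
  field_simp
  ring
end

section
/- Let γ ≠ 0 be real, μ₁, μ₂ > 0, x > 0 and t > 0. Then the Mellin convolution of the generalized gamma densities satisfies ∫_0^∞ g^γ_{μ₁}(x/s, t) · g^{−γ}_{μ₂}(s, 1) · ds/s = (|γ| / B(μ₁,μ₂)) · x^{γμ₁−1} t^{γμ₂} / (t^γ + x^γ)^{μ₁+μ₂}, where B(μ₁,μ₂) = Γ(μ₁)Γ(μ₂)/Γ(μ₁+μ₂) is the Beta function. -/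
open MeasureTheory Real

/-- Generalized gamma density `g^γ_μ(x,t) = |γ| x^(γμ-1) e^(-(x/t)^γ) / (Γ(μ) t^(γμ))`. -/
noncomputable def genGamma (γ μ x t : ℝ) : ℝ :=
  |γ| * x ^ (γ * μ - 1) * Real.exp (-((x / t) ^ γ)) / (Real.Gamma μ * t ^ (γ * μ))

/-- Formula (gConv) of the paper: the Mellin convolution
`g^γ_(μ₁)(·,t) ⋆ g^(-γ)_(μ₂)(·,1)` is
`(|γ|/B(μ₁,μ₂)) x^(γμ₁-1) t^(γμ₂) / (t^γ + x^γ)^(μ₁+μ₂)`. -/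
theorem genGamma_mellin_conv_opposite (γ μ₁ μ₂ x t : ℝ) (hγ : γ ≠ 0)
    (hμ₁ : 0 < μ₁) (hμ₂ : 0 < μ₂) (hx : 0 < x) (ht : 0 < t) :
    (∫ s in Set.Ioi (0:ℝ), genGamma γ μ₁ (x / s) t * genGamma (-γ) μ₂ s 1 / s) =
      (|γ| * Real.Gamma (μ₁ + μ₂) / (Real.Gamma μ₁ * Real.Gamma μ₂)) *
        x ^ (γ * μ₁ - 1) * t ^ (γ * μ₂) / (t ^ γ + x ^ γ) ^ (μ₁ + μ₂) := by
  have hr : 0 < 1 + (x / t) ^ γ := by positivity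
  have hμ : 0 < μ₁ + μ₂ := by linarith
  have hG1 : Real.Gamma μ₁ ≠ 0 := (Real.Gamma_pos_of_pos hμ₁).ne'
  have hG2 : Real.Gamma μ₂ ≠ 0 := (Real.Gamma_pos_of_pos hμ₂).ne'
  have key : ∀ s ∈ Set.Ioi (0:ℝ), genGamma γ μ₁ (x / s) t * genGamma (-γ) μ₂ s 1 / s =
      (|γ| * x ^ (γ * μ₁ - 1) / (Real.Gamma μ₁ * Real.Gamma μ₂ * t ^ (γ * μ₁))) *
      ((|-γ| * s ^ (-γ - 1)) • ((s ^ (-γ)) ^ (μ₁ + μ₂ - 1) *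
        Real.exp (-((1 + (x / t) ^ γ) * s ^ (-γ))))) := by
    intro s hs
    have hs : 0 < s := hs
    have e1 : (x / s / t) ^ γ = (x / t) ^ γ * s ^ (-γ) := by
      rw [show x / s / t = (x / t) / s by field_simp, Real.div_rpow (by positivity) hs.le,
        Real.rpow_neg hs.le, div_eq_mul_inv]
    have e2 : Real.exp (-((1 + (x / t) ^ γ) * s ^ (-γ))) =
        Real.exp (-((x / t) ^ γ * s ^ (-γ))) * Real.exp (-(s ^ (-γ))) := by
      rw [← Real.exp_add]; congr 1; ring
    have e3 : (x / s) ^ (γ * μ₁ - 1) = x ^ (γ * μ₁ - 1) * s ^ (-(γ * μ₁ - 1)) := by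
      rw [Real.div_rpow hx.le hs.le, Real.rpow_neg hs.le, div_eq_mul_inv]
    have e4 : s ^ (-(γ * μ₁ - 1)) * s ^ (-γ * μ₂ - 1) / s =
        s ^ (-γ - 1) * (s ^ (-γ)) ^ (μ₁ + μ₂ - 1) := by
      rw [← Real.rpow_mul hs.le, ← Real.rpow_add hs, ← Real.rpow_add hs,
        ← Real.rpow_sub_one hs.ne']
      congr 1; ring
    unfold genGamma
    rw [e1, e2, e3, div_one, Real.one_rpow, abs_neg, smul_eq_mul]
    have ht' : t ^ (γ * μ₁) ≠ 0 := by positivity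
    calc _ = (|γ| * x ^ (γ * μ₁ - 1) / (Real.Gamma μ₁ * Real.Gamma μ₂ * t ^ (γ * μ₁))) *
          (|γ| * (s ^ (-(γ * μ₁ - 1)) * s ^ (-γ * μ₂ - 1) / s) *
          (Real.exp (-((x / t) ^ γ * s ^ (-γ))) * Real.exp (-(s ^ (-γ))))) := by
            field_simp
      _ = _ := by rw [e4]; ring
  rw [setIntegral_congr_fun measurableSet_Ioi key, integral_const_mul,
    integral_comp_rpow_Ioi (fun y => y ^ (μ₁ + μ₂ - 1) *
        Real.exp (-((1 + (x / t) ^ γ) * y))) (neg_ne_zero.mpr hγ),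
    Real.integral_rpow_mul_exp_neg_mul_Ioi hμ hr]
  have hA : 0 < t ^ γ := by positivity
  have hB : 0 < t ^ γ + x ^ γ := by positivity
  have e5 : 1 / (1 + (x / t) ^ γ) = t ^ γ / (t ^ γ + x ^ γ) := by
    rw [Real.div_rpow hx.le ht.le]; field_simp
  have e6 : (t ^ γ) ^ (μ₁ + μ₂) = t ^ (γ * μ₁) * t ^ (γ * μ₂) := by
    rw [← Real.rpow_mul ht.le, ← Real.rpow_add ht]; congr 1; ring
  rw [e5, Real.div_rpow hA.le hB.le, e6]
  have ht' : t ^ (γ * μ₁) ≠ 0 := by positivity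
  have hB' : (t ^ γ + x ^ γ) ^ (μ₁ + μ₂) ≠ 0 := by positivity
  field_simp
end

section
/- Let γ ≠ 0 be real, μ₁, μ₂ > 0 with μ₂ − μ₁ not an integer, x > 0 and t > 0. Then ∫_0^∞ g^γ_{μ₁}(x/s, t) · g^γ_{μ₂}(s, 1) · ds/s = (2|γ| (x^γ/t^γ)^{(μ₁+μ₂)/2} / (x Γ(μ₁) Γ(μ₂))) · K_{μ₂−μ₁}( 2 (x^γ/t^γ)^{1/2} ), where K_α(z) = (π/2)(I_{−α}(z) − I_α(z))/sin(απ) and I_α(z) = Σ_{k≥0} (z/2)^{α+2k}/(k! Γ(α+k+1)). -/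
open MeasureTheory Real

/-- Modified Bessel function of the first kind
`I_α(z) = Σ_{k≥0} (z/2)^(α+2k) / (k! Γ(α+k+1))`. -/
noncomputable def besselI (α z : ℝ) : ℝ :=
  ∑' k : ℕ, (z / 2) ^ (α + 2 * (k : ℝ)) / ((k.factorial : ℝ) * Real.Gamma (α + k + 1))

/-- Macdonald function for non-integer order:
`K_α(z) = (π/2)(I_(-α)(z) - I_α(z)) / sin(απ)`. -/
noncomputable def besselK (α z : ℝ) : ℝ :=
  (Real.pi / 2) * (besselI (-α) z - besselI α z) / Real.sin (α * Real.pi)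

open Filter Topology

noncomputable def auxA (a y : ℝ) : ℝ :=
  ∑' k : ℕ, y ^ k / ((k.factorial : ℝ) * Real.Gamma (a + k + 1))

lemma aux_bound (a : ℝ) : ∃ C : ℝ, 0 ≤ C ∧ ∀ k : ℕ, |(Real.Gamma (a + k + 1))⁻¹| ≤ C := by
  obtain ⟨N, hN⟩ := exists_nat_gt (1 - a)
  refine ⟨1 + ∑ k ∈ Finset.range N, |(Real.Gamma (a + k + 1))⁻¹|, ?_, ?_⟩
  · have : 0 ≤ ∑ k ∈ Finset.range N, |(Real.Gamma (a + k + 1))⁻¹| :=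
      Finset.sum_nonneg fun _ _ => abs_nonneg _
    linarith
  · intro k
    have hs : 0 ≤ ∑ k ∈ Finset.range N, |(Real.Gamma (a + k + 1))⁻¹| :=
      Finset.sum_nonneg fun _ _ => abs_nonneg _
    by_cases hk : k < N
    · have := Finset.single_le_sum (f := fun k : ℕ => |(Real.Gamma (a + k + 1))⁻¹|)
        (fun _ _ => abs_nonneg _) (Finset.mem_range.2 hk)
      linarith
    · have hk' : (N : ℝ) ≤ k := by exact_mod_cast not_lt.1 hk
      have h2 : (2 : ℝ) ≤ a + k + 1 := by linarith
      have h1 : 1 ≤ Real.Gamma (a + k + 1) := by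
        have := Real.Gamma_strictMonoOn_Ici.monotoneOn (Set.mem_Ici.2 le_rfl) (Set.mem_Ici.2 h2) h2
        rwa [Real.Gamma_two] at this
      have : |(Real.Gamma (a + k + 1))⁻¹| ≤ 1 := by
        rw [abs_of_nonneg (by positivity)]
        exact inv_le_one_of_one_le₀ h1
      linarith

lemma auxA_summable (a y : ℝ) :
    Summable fun k : ℕ => y ^ k / ((k.factorial : ℝ) * Real.Gamma (a + k + 1)) := by
  obtain ⟨C, hC, h⟩ := aux_bound a
  refine Summable.of_norm_bounded ((Real.summable_pow_div_factorial |y|).mul_left C) ?_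
  intro k
  have : y ^ k / ((k.factorial : ℝ) * Real.Gamma (a + k + 1)) =
    (Real.Gamma (a + k + 1))⁻¹ * (y ^ k / k.factorial) := by
    rw [div_mul_eq_div_div, div_eq_mul_inv _ (Real.Gamma _), mul_comm]
  rw [this, norm_mul, Real.norm_eq_abs, Real.norm_eq_abs, abs_div, abs_pow, Nat.abs_cast]
  exact mul_le_mul_of_nonneg_right (h k) (by positivity)

lemma aux_dsum (M : ℝ) : Summable fun k : ℕ => (k * M ^ (k - 1) / (k.factorial : ℝ)) := by
  rw [← summable_nat_add_iff 1]
  refine (Real.summable_pow_div_factorial M).congr ?_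
  intro k
  rw [Nat.factorial_succ]
  push_cast
  have : (k.factorial : ℝ) ≠ 0 := by positivity
  have : (k : ℝ) + 1 ≠ 0 := by positivity
  field_simp

lemma aux_dsum' (a y : ℝ) : Summable fun k : ℕ =>
    k * y ^ (k - 1) / ((k.factorial : ℝ) * Real.Gamma (a + k + 1)) := by
  obtain ⟨C, hC, h⟩ := aux_bound a
  refine Summable.of_norm_bounded ((aux_dsum |y|).mul_left C) ?_
  intro k
  have : k * y ^ (k-1) / ((k.factorial : ℝ) * Real.Gamma (a + k + 1)) =
    (Real.Gamma (a + k + 1))⁻¹ * (k * y ^ (k-1) / k.factorial) := by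
    rw [div_mul_eq_div_div, div_eq_mul_inv _ (Real.Gamma _), mul_comm]
  rw [this, norm_mul, Real.norm_eq_abs, Real.norm_eq_abs, abs_div, abs_mul, abs_pow, Nat.abs_cast,
    Nat.abs_cast]
  exact mul_le_mul_of_nonneg_right (h k) (by positivity)

lemma auxA_hasDerivAt' (a y : ℝ) : HasDerivAt (auxA a)
    (∑' k : ℕ, k * y ^ (k - 1) / ((k.factorial : ℝ) * Real.Gamma (a + k + 1))) y := by
  obtain ⟨C, hC, h⟩ := aux_bound a
  have hy : y ∈ Set.Ioo (-(|y| + 1)) (|y| + 1) := by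
    rw [Set.mem_Ioo, ← abs_lt]; linarith
  refine hasDerivAt_tsum_of_isPreconnected (t := Set.Ioo (-(|y| + 1)) (|y| + 1)) (y₀ := y)
    ((aux_dsum (|y| + 1)).mul_left C) isOpen_Ioo isPreconnected_Ioo
    (g := fun (k : ℕ) y => y ^ k / ((k.factorial : ℝ) * Real.Gamma (a + k + 1)))
    (g' := fun (k : ℕ) y => k * y ^ (k-1) / ((k.factorial : ℝ) * Real.Gamma (a + k + 1)))
    ?_ ?_ hy (auxA_summable a y) hy
  · intro k z _
    exact (hasDerivAt_pow k z).div_const _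
  · intro k z hz
    have hz' : |z| ≤ |y| + 1 := (abs_lt.2 hz).le
    have : k * z ^ (k-1) / ((k.factorial : ℝ) * Real.Gamma (a + k + 1)) =
      (Real.Gamma (a + k + 1))⁻¹ * (k * z ^ (k-1) / k.factorial) := by
      rw [div_mul_eq_div_div, div_eq_mul_inv _ (Real.Gamma _), mul_comm]
    rw [this, norm_mul, Real.norm_eq_abs, Real.norm_eq_abs, abs_div, abs_mul, abs_pow, Nat.abs_cast,
      Nat.abs_cast]
    refine mul_le_mul (h k) ?_ (by positivity) hC
    gcongr

lemma auxA_deriv_eq (a y : ℝ) :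
    (∑' k : ℕ, k * y ^ (k - 1) / ((k.factorial : ℝ) * Real.Gamma (a + k + 1))) = auxA (a + 1) y := by
  rw [(aux_dsum' a y).tsum_eq_zero_add, auxA]
  simp only [Nat.cast_zero, zero_mul, zero_div, zero_add]
  refine tsum_congr fun k => ?_
  rw [Nat.factorial_succ]
  push_cast
  rw [show a + ((k : ℝ) + 1) + 1 = a + 1 + k + 1 by ring]
  have : (k.factorial : ℝ) ≠ 0 := by positivity
  have : (k : ℝ) + 1 ≠ 0 := by positivity
  rw [mul_assoc, mul_div_mul_left _ _ this]

lemma auxA_hasDerivAt (a y : ℝ) : HasDerivAt (auxA a) (auxA (a + 1) y) y := by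
  rw [← auxA_deriv_eq]; exact auxA_hasDerivAt' a y

lemma auxA_rec (a y : ℝ) (ha : ∀ n : ℤ, a ≠ n) :
    a * auxA a y + y * auxA (a + 1) y = auxA (a - 1) y := by
  rw [← auxA_deriv_eq, auxA, auxA, ← tsum_mul_left, ← tsum_mul_left,
    ← ((auxA_summable a y).mul_left a).tsum_add ((aux_dsum' a y).mul_left y)]
  refine tsum_congr fun k => ?_
  have h0 : a + k ≠ 0 := by
    intro h
    apply ha (-k)
    push_cast; linarith
  rw [show a - 1 + k + 1 = a + (k : ℝ) by ring, Real.Gamma_add_one h0]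
  have hy : y * (k * y ^ (k - 1)) = k * y ^ k := by
    rcases k with _ | k
    · simp
    · simp [pow_succ]; ring
  have hG : Real.Gamma (a + k) ≠ 0 := by
    apply Real.Gamma_ne_zero
    intro m h
    apply ha (-m - k)
    push_cast; linarith
  have : (k.factorial : ℝ) ≠ 0 := by positivity
  rw [← mul_div_assoc, ← mul_div_assoc, hy]
  field_simp

lemma auxA_zero (a : ℝ) : auxA a 0 = (Real.Gamma (a + 1))⁻¹ := by
  rw [auxA, tsum_eq_single 0]
  · simp
  · intro k hk; simp [hk]

noncomputable def auxR (a y : ℝ) : ℝ :=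
  Real.pi / Real.sin (a * Real.pi) * (auxA (-a) y - y ^ a * auxA a y)

lemma auxR_symm (a y : ℝ) (hy : 0 < y) : auxR a y = y ^ a * auxR (-a) y := by
  unfold auxR
  have : y ^ a * y ^ (-a) = 1 := by rw [← Real.rpow_add hy]; simp
  rw [neg_mul, Real.sin_neg, neg_neg, div_neg]
  linear_combination (-Real.pi / Real.sin (a * Real.pi) * auxA (-a) y) * this

lemma auxR_hasDerivAt (a y : ℝ) (ha : ∀ n : ℤ, a ≠ n) (hy : 0 < y) :
    HasDerivAt (auxR a) (-auxR (a - 1) y) y := by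
  have h := (((auxA_hasDerivAt (-a) y).sub
    ((Real.hasDerivAt_rpow_const (p := a) (Or.inl hy.ne')).mul (auxA_hasDerivAt a y))).const_mul
    (Real.pi / Real.sin (a * Real.pi)))
  refine h.congr_deriv ?_
  unfold auxR
  have hs : Real.sin ((a - 1) * Real.pi) = - Real.sin (a * Real.pi) := by
    rw [sub_mul, one_mul, Real.sin_sub_pi]
  rw [hs, ← auxA_rec a y ha, show -a + 1 = -(a - 1) by ring, div_neg]
  have : y ^ a = y ^ (a - 1) * y := by
    rw [← Real.rpow_add_one hy.ne']; simp
  rw [this]; ring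

lemma auxR_tendsto (a : ℝ) (ha0 : 0 < a) (ha1 : a < 1) :
    Tendsto (auxR a) (𝓝[>] 0) (𝓝 (Real.Gamma a)) := by
  have h1 : Tendsto (auxA (-a)) (𝓝[>] 0) (𝓝 (auxA (-a) 0)) :=
    (auxA_hasDerivAt (-a) 0).continuousAt.tendsto.mono_left nhdsWithin_le_nhds
  have h2 : Tendsto (auxA a) (𝓝[>] 0) (𝓝 (auxA a 0)) :=
    (auxA_hasDerivAt a 0).continuousAt.tendsto.mono_left nhdsWithin_le_nhds
  have h3 : Tendsto (fun y : ℝ => y ^ a) (𝓝[>] 0) (𝓝 ((0:ℝ) ^ a)) :=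
    (Real.continuousAt_rpow_const 0 a (Or.inr ha0.le)).tendsto.mono_left nhdsWithin_le_nhds
  have h := (h1.sub (h3.mul h2)).const_mul (Real.pi / Real.sin (a * Real.pi))
  suffices e : Real.pi / Real.sin (a * Real.pi) * (auxA (-a) 0 - (0:ℝ) ^ a * auxA a 0)
      = Real.Gamma a by
    rw [e] at h; exact h
  rw [Real.zero_rpow ha0.ne', zero_mul, sub_zero, auxA_zero, mul_comm a,
    ← Real.Gamma_mul_Gamma_one_sub, show -a + 1 = 1 - a by ring]
  have := (Real.Gamma_pos_of_pos (show 0 < 1 - a by linarith)).ne'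
  field_simp

noncomputable def auxF (a y : ℝ) : ℝ :=
  ∫ u in Set.Ioi (0:ℝ), u ^ (a - 1) * Real.exp (-u - y / u)

lemma auxF_meas (a y : ℝ) : AEStronglyMeasurable
    (fun u : ℝ => u ^ (a - 1) * Real.exp (-u - y / u)) (volume.restrict (Set.Ioi 0)) := by
  apply Measurable.aestronglyMeasurable
  fun_prop

lemma auxF_integrable (a y : ℝ) (hy : 0 < y) : IntegrableOn
    (fun u : ℝ => u ^ (a - 1) * Real.exp (-u - y / u)) (Set.Ioi 0) := by
  obtain ⟨n, hn⟩ := exists_nat_gt (-a)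
  have hb := (Real.GammaIntegral_convergent (s := a + n) (by linarith)).const_mul
    (n.factorial / y ^ n)
  refine Integrable.mono' hb (auxF_meas a y) ?_
  filter_upwards [ae_restrict_mem measurableSet_Ioi] with u (hu : 0 < u)
  rw [Real.norm_of_nonneg (by positivity), show -u - y / u = -u + -(y/u) by ring, Real.exp_add]
  have h1 := Real.pow_div_factorial_le_exp (y / u) (by positivity) n
  have h2 : Real.exp (-(y/u)) ≤ n.factorial / y ^ n * u ^ n := by
    rw [Real.exp_neg]
    refine (inv_anti₀ (by positivity) h1).trans (le_of_eq ?_)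
    rw [div_pow]
    field_simp
  calc u ^ (a - 1) * (Real.exp (-u) * Real.exp (-(y/u)))
      ≤ u ^ (a - 1) * (Real.exp (-u) * (n.factorial / y ^ n * u ^ n)) := by gcongr
    _ = n.factorial / y ^ n * (Real.exp (-u) * (u ^ (a-1) * u ^ (n:ℝ))) := by
        rw [Real.rpow_natCast]; ring
    _ = _ := by rw [← Real.rpow_add hu, show a - 1 + n = a + n - 1 by ring]

lemma auxF_hasDerivAt (a y : ℝ) (hy : 0 < y) : HasDerivAt (auxF a) (-auxF (a - 1) y) y := by
  have key := hasDerivAt_integral_of_dominated_loc_of_deriv_le (μ := volume.restrict (Set.Ioi (0:ℝ)))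
    (F := fun y u : ℝ => u ^ (a - 1) * Real.exp (-u - y / u))
    (F' := fun y u : ℝ => -(u ^ (a - 1 - 1) * Real.exp (-u - y / u)))
    (bound := fun u : ℝ => u ^ (a - 1 - 1) * Real.exp (-u - (y / 2) / u))
    (x₀ := y) (s := Set.Ioi (y / 2)) (Ioi_mem_nhds (by linarith))
    (Eventually.of_forall fun z => auxF_meas a z) (auxF_integrable a y hy)
    (auxF_meas (a - 1) y).neg ?_ (auxF_integrable (a - 1) (y / 2) (by linarith)) ?_
  · have h := key.2
    rw [integral_neg] at h
    exact h
  · filter_upwards [ae_restrict_mem measurableSet_Ioi] with u (hu : 0 < u) z (hz : y / 2 < z)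
    rw [norm_neg, Real.norm_of_nonneg (by positivity)]
    gcongr
  · filter_upwards [ae_restrict_mem measurableSet_Ioi] with u (hu : 0 < u) z (hz : y / 2 < z)
    have h1 : HasDerivAt (fun z : ℝ => -u - z / u) (-(1 / u)) z :=
      ((hasDerivAt_id z).div_const u).const_sub (-u)
    refine (h1.exp.const_mul (u ^ (a - 1))).congr_deriv ?_
    rw [Real.rpow_sub_one hu.ne' (a - 1)]
    ring

lemma auxF_symm (a y : ℝ) (hy : 0 < y) : auxF a y = y ^ a * auxF (-a) y := by
  unfold auxF
  rw [← MeasureTheory.integral_comp_rpow_Ioi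
    (fun u : ℝ => u ^ (a - 1) * Real.exp (-u - y / u)) (p := -1) (by norm_num)]
  have h := MeasureTheory.integral_comp_mul_left_Ioi
    (fun x : ℝ => (|(-1:ℝ)| * x ^ ((-1:ℝ) - 1)) • 
      ((x ^ (-1:ℝ)) ^ (a - 1) * Real.exp (-x ^ (-1:ℝ) - y / x ^ (-1:ℝ)))) 0 (inv_pos.2 hy)
  rw [mul_zero, inv_inv, smul_eq_mul] at h
  have h' := congrArg (fun z => y⁻¹ * z) h
  rw [inv_mul_cancel_left₀ hy.ne'] at h'
  rw [← h', ← integral_const_mul, ← integral_const_mul]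
  refine setIntegral_congr_fun measurableSet_Ioi fun u (hu : 0 < u) => ?_
  simp only [smul_eq_mul, abs_neg, abs_one, one_mul]
  have e1 : (y⁻¹ * u) ^ (-1:ℝ) = y / u := by
    rw [Real.rpow_neg_one, mul_inv, inv_inv]; rfl
  have e2 : (y⁻¹ * u) ^ ((-1:ℝ) - 1) = (y / u) ^ 2 := by
    rw [Real.rpow_sub_one (by positivity), e1]; field_simp
  rw [e1, e2, show y / (y / u) = u by field_simp, show -(y / u) - u = -u - y / u by ring,
    Real.div_rpow hy.le hu.le, Real.rpow_sub_one hy.ne', Real.rpow_sub_one hu.ne',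
    Real.rpow_sub_one hu.ne', Real.rpow_neg hu.le]
  have : u ^ a ≠ 0 := by positivity
  field_simp

lemma auxF_tendsto (a : ℝ) (ha : 0 < a) : Tendsto (auxF a) (𝓝[>] 0) (𝓝 (Real.Gamma a)) := by
  rw [Real.Gamma_eq_integral ha]
  refine tendsto_integral_filter_of_dominated_convergence
    (fun u : ℝ => Real.exp (-u) * u ^ (a - 1)) (Eventually.of_forall fun z => auxF_meas a z) ?_
    (Real.GammaIntegral_convergent ha) ?_
  · filter_upwards [self_mem_nhdsWithin] with y (hy : 0 < y)
    filter_upwards [ae_restrict_mem measurableSet_Ioi] with u (hu : 0 < u)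
    rw [Real.norm_of_nonneg (by positivity), mul_comm]
    have : 0 ≤ y / u := by positivity
    gcongr
    linarith
  · filter_upwards [ae_restrict_mem measurableSet_Ioi] with u (hu : 0 < u)
    have hc : Continuous fun y : ℝ => u ^ (a - 1) * Real.exp (-u - y / u) := by fun_prop
    have := (hc.tendsto 0).mono_left (nhdsWithin_le_nhds (s := Set.Ioi 0))
    simpa [mul_comm] using this

lemma aux_gronwall (a : ℝ) (ha0 : 0 < a) (ha1 : a < 1) (D E : ℝ → ℝ)
    (hD : ∀ y, 0 < y → HasDerivAt D (y ^ (a - 1) * E y) y)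
    (hE : ∀ y, 0 < y → HasDerivAt E (y ^ (-a) * D y) y)
    (hD0 : Tendsto D (𝓝[>] 0) (𝓝 0)) (hE0 : Tendsto E (𝓝[>] 0) (𝓝 0)) (y : ℝ) (hy : 0 < y) :
    D y = 0 := by
  set W : ℝ → ℝ := fun y => (D y ^ 2 + E y ^ 2) * Real.exp (-(y ^ a / a + y ^ (1 - a) / (1 - a)))
    with hW
  have h1a : 0 < 1 - a := by linarith
  have hWd : ∀ y, 0 < y → HasDerivAt W
      (-(D y - E y) ^ 2 * (y ^ (a - 1) + y ^ (-a)) *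
        Real.exp (-(y ^ a / a + y ^ (1 - a) / (1 - a)))) y := by
    intro y hy
    have e1 := (Real.hasDerivAt_rpow_const (x := y) (p := a) (Or.inl hy.ne')).div_const a
    have e2 := (Real.hasDerivAt_rpow_const (x := y) (p := 1 - a) (Or.inl hy.ne')).div_const (1 - a)
    have h := (((hD y hy).pow 2).add ((hE y hy).pow 2)).mul ((e1.add e2).neg.exp)
    refine h.congr_deriv ?_
    rw [mul_div_cancel_left₀ _ ha0.ne', mul_div_cancel_left₀ _ h1a.ne',
      show 1 - a - 1 = -a by ring]
    simp
    ring
  have hanti : AntitoneOn W (Set.Ioi 0) := by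
    refine antitoneOn_of_deriv_nonpos (convex_Ioi 0)
      (fun z hz => (hWd z hz).continuousAt.continuousWithinAt)
      (fun z hz => ?_) (fun z hz => ?_)
    · rw [interior_Ioi] at hz
      exact (hWd z hz).differentiableAt.differentiableWithinAt
    · rw [interior_Ioi] at hz
      rw [(hWd z hz).deriv]
      have hz' : 0 < z := hz
      rw [neg_mul, neg_mul]
      exact neg_nonpos.2 (by positivity)
  have hc : ∀ b : ℝ, 0 < b → Tendsto (fun y : ℝ => y ^ b) (𝓝[>] 0) (𝓝 ((0:ℝ) ^ b)) := fun b hb =>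
    (Real.continuousAt_rpow_const 0 b (Or.inr hb.le)).tendsto.mono_left nhdsWithin_le_nhds
  have hW0 : Tendsto W (𝓝[>] 0) (𝓝 0) := by
    have h := ((hD0.pow 2).add (hE0.pow 2)).mul
      ((Real.continuous_exp.tendsto _).comp
        (((hc a ha0).div_const a).add ((hc (1 - a) h1a).div_const (1 - a))).neg)
    have e0 : ((0:ℝ) ^ 2 + (0:ℝ) ^ 2) = 0 := by norm_num
    rw [e0, zero_mul] at h
    exact h
  have hle : W y ≤ 0 := by
    refine ge_of_tendsto hW0 ?_
    filter_upwards [Ioc_mem_nhdsGT hy] with z hz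
    exact hanti hz.1 hy hz.2
  have : D y ^ 2 + E y ^ 2 ≤ 0 := by
    by_contra hcon
    push Not at hcon
    have : 0 < W y := mul_pos hcon (Real.exp_pos _)
    linarith
  nlinarith [sq_nonneg (D y), sq_nonneg (E y)]

lemma aux_base (a : ℝ) (ha0 : 0 < a) (ha1 : a < 1) (y : ℝ) (hy : 0 < y) : auxF a y = auxR a y := by
  have hni : ∀ n : ℤ, a ≠ n := by
    rintro n rfl
    have h1 : 0 < n := by exact_mod_cast ha0
    have h2 : n < 1 := by exact_mod_cast ha1
    omega
  have hni' : ∀ n : ℤ, 1 - a ≠ n := by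
    intro n h
    apply hni (1 - n)
    push_cast; linarith
  have key := aux_gronwall a ha0 ha1 (fun y => auxF a y - auxR a y)
    (fun y => -(auxF (1 - a) y - auxR (1 - a) y)) ?_ ?_ ?_ ?_ y hy
  · exact sub_eq_zero.1 key
  · intro y hy
    refine ((auxF_hasDerivAt a y hy).sub (auxR_hasDerivAt a y hni hy)).congr_deriv ?_
    rw [auxF_symm (a - 1) y hy, auxR_symm (a - 1) y hy, neg_sub]; ring
  · intro y hy
    refine ((auxF_hasDerivAt (1 - a) y hy).sub (auxR_hasDerivAt (1 - a) y hni' hy)).neg.congr_deriv ?_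
    rw [show 1 - a - 1 = -a by ring, auxF_symm (-a) y hy, auxR_symm (-a) y hy, neg_neg]; ring
  · simpa using (auxF_tendsto a ha0).sub (auxR_tendsto a ha0 ha1)
  · simpa using ((auxF_tendsto (1 - a) (by linarith)).sub
      (auxR_tendsto (1 - a) (by linarith) (by linarith))).neg

lemma aux_desc (n : ℕ) (a : ℝ) (ha0 : 0 < a) (ha1 : a < 1) :
    ∀ y, 0 < y → auxF (a - n) y = auxR (a - n) y := by
  induction n with
  | zero => simpa using aux_base a ha0 ha1
  | succ n ih =>
    intro y hy
    have hni : ∀ m : ℤ, a - n ≠ m := by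
      intro m h
      have h' : a = ((m + n : ℤ) : ℝ) := by push_cast; linarith
      rw [h'] at ha0 ha1
      have h1 : 0 < m + n := by exact_mod_cast ha0
      have h2 : m + n < 1 := by exact_mod_cast ha1
      omega
    have h1 := auxF_hasDerivAt (a - n) y hy
    have h2 := auxR_hasDerivAt (a - n) y hni hy
    have h3 : auxF (a - n) =ᶠ[𝓝 y] auxR (a - n) := by
      filter_upwards [Ioi_mem_nhds hy] with z hz using ih z hz
    have h4 := (h2.congr_of_eventuallyEq h3).unique h1
    push_cast
    rw [← sub_sub]
    linarith

lemma aux_main (a : ℝ) (ha : ∀ n : ℤ, a ≠ n) (y : ℝ) (hy : 0 < y) : auxF a y = auxR a y := by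
  have neg_case : ∀ a : ℝ, (∀ n : ℤ, a ≠ n) → a < 0 → auxF a y = auxR a y := by
    intro a ha h
    have hf0 : 0 < Int.fract a := Int.fract_pos.2 (ha _)
    have hfl : ⌊a⌋ ≤ 0 := by
      rw [← Int.cast_nonpos (R := ℝ)]; exact (Int.floor_le a).trans h.le
    obtain ⟨n, hn⟩ := Int.eq_ofNat_of_zero_le (neg_nonneg.2 hfl)
    have := aux_desc n (Int.fract a) hf0 (Int.fract_lt_one a) y hy
    have e : Int.fract a - n = a := by
      have : (n : ℝ) = -(⌊a⌋ : ℝ) := by exact_mod_cast hn.symm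
      rw [this, Int.fract]; ring
    rwa [e] at this
  rcases lt_trichotomy a 0 with h | h | h
  · exact neg_case a ha h
  · exact absurd h (by simpa using ha 0)
  · rw [auxF_symm a y hy, auxR_symm a y hy, neg_case (-a) _ (by linarith)]
    intro n h
    apply ha (-n)
    push_cast; linarith

lemma besselI_eq (a y : ℝ) (hy : 0 < y) :
    besselI a (2 * y ^ ((1:ℝ) / 2)) = y ^ (a / 2) * auxA a y := by
  unfold besselI auxA
  rw [← tsum_mul_left]
  refine tsum_congr fun k => ?_
  rw [mul_div_cancel_left₀ _ (two_ne_zero), ← Real.rpow_mul hy.le,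
    show (1:ℝ) / 2 * (a + 2 * k) = a / 2 + k by ring, Real.rpow_add hy, Real.rpow_natCast,
    mul_div_assoc]

lemma besselK_eq (a y : ℝ) (hy : 0 < y) :
    2 * y ^ (a / 2) * besselK a (2 * y ^ ((1:ℝ) / 2)) = auxR a y := by
  unfold besselK auxR
  rw [besselI_eq _ _ hy, besselI_eq _ _ hy]
  have h1 : y ^ (a / 2) * y ^ (-a / 2) = 1 := by rw [← Real.rpow_add hy]; ring_nf; simp
  have h2 : y ^ (a / 2) * y ^ (a / 2) = y ^ a := by rw [← Real.rpow_add hy]; ring_nf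
  rw [← h2]
  linear_combination (Real.pi / Real.sin (a * Real.pi) * auxA (-a) y) * h1

/-- Formula (eConv) of the paper: the Mellin convolution
`g^γ_(μ₁)(·,t) ⋆ g^γ_(μ₂)(·,1)` equals
`(2|γ| (x^γ/t^γ)^((μ₁+μ₂)/2) / (x Γ(μ₁) Γ(μ₂))) K_(μ₂-μ₁)(2 √(x^γ/t^γ))`. -/
theorem genGamma_mellin_conv_same (γ μ₁ μ₂ x t : ℝ) (hγ : γ ≠ 0)
    (hμ₁ : 0 < μ₁) (hμ₂ : 0 < μ₂) (hint : ∀ n : ℤ, μ₂ - μ₁ ≠ n)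
    (hx : 0 < x) (ht : 0 < t) :
    (∫ s in Set.Ioi (0:ℝ), genGamma γ μ₁ (x / s) t * genGamma γ μ₂ s 1 / s) =
      (2 * |γ| * (x ^ γ / t ^ γ) ^ ((μ₁ + μ₂) / 2) /
          (x * Real.Gamma μ₁ * Real.Gamma μ₂)) *
        besselK (μ₂ - μ₁) (2 * (x ^ γ / t ^ γ) ^ ((1:ℝ) / 2)) := by
  set y := x ^ γ / t ^ γ with hydef
  have hy : 0 < y := by positivity
  have hG1 := (Real.Gamma_pos_of_pos hμ₁).ne'
  have hG2 := (Real.Gamma_pos_of_pos hμ₂).ne'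
  have hK := besselK_eq (μ₂ - μ₁) y hy
  rw [← aux_main _ hint y hy] at hK
  have hr : (2 * |γ| * y ^ ((μ₁ + μ₂) / 2) / (x * Real.Gamma μ₁ * Real.Gamma μ₂)) *
        besselK (μ₂ - μ₁) (2 * y ^ ((1:ℝ) / 2)) =
      |γ| * y ^ μ₁ / (x * Real.Gamma μ₁ * Real.Gamma μ₂) * auxF (μ₂ - μ₁) y := by
    rw [← hK, show (μ₁ + μ₂) / 2 = μ₁ + (μ₂ - μ₁) / 2 by ring, Real.rpow_add hy]
    ring
  rw [hr, auxF, ← MeasureTheory.integral_comp_rpow_Ioi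
    (fun u : ℝ => u ^ (μ₂ - μ₁ - 1) * Real.exp (-u - y / u)) hγ, ← integral_const_mul]
  refine setIntegral_congr_fun measurableSet_Ioi fun s (hs : 0 < s) => ?_
  simp only [genGamma, smul_eq_mul]
  have e1 : (x / s / t) ^ γ = y / s ^ γ := by
    rw [Real.div_rpow (by positivity) ht.le, Real.div_rpow hx.le hs.le, hydef, div_right_comm]
  have e2 : y ^ μ₁ = x ^ (γ * μ₁) / t ^ (γ * μ₁) := by
    rw [hydef, Real.div_rpow (by positivity) (by positivity), ← Real.rpow_mul hx.le,
      ← Real.rpow_mul ht.le]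
  rw [e1, e2, div_one, Real.one_rpow, mul_one, sub_eq_add_neg (-s ^ γ), add_comm (-s ^ γ),
    Real.exp_add, Real.div_rpow hx.le hs.le, ← Real.rpow_mul hs.le,
    show γ * (μ₂ - μ₁ - 1) = γ * μ₂ - γ * μ₁ - γ by ring, Real.rpow_sub hs _ γ, Real.rpow_sub hs _ (γ * μ₁),
    Real.rpow_sub_one hs.ne', Real.rpow_sub_one hs.ne', Real.rpow_sub_one hs.ne',
    Real.rpow_sub_one hx.ne']
  have := (Real.rpow_pos_of_pos hs γ).ne'
  have := (Real.rpow_pos_of_pos hs (γ * μ₁)).ne'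
  have := (Real.rpow_pos_of_pos ht (γ * μ₁)).ne'
  field_simp
end
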